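/- For all i, j ∈ I and every integer d ≥ 1: 𝒩(e_i(0), e_j(d)) = (β(e_i(0)), β(e_j(d))), where (x,y) = ⟨x,y⟩ + ⟨y,x⟩ is the symmetrized Euler form on ℤ^n. -/

import Mathlib

namespace GQV

open Matrix

/-- Degree shift `η[d]`, i.e. `η[d]ᵢ(a) = ηᵢ(a + d)`. -/
noncomputable def shift {n : ℕ} (η : Fin n × ℝ → ℤ) (d : ℝ) : Fin n × ℝ → ℤ :=
  fun p => η (p.1, p.2 + d)

/-- The q-Cartan operator `C_q`. -/
noncomputable def Cq {n : ℕ} (b : Matrix (Fin n) (Fin n) ℤ) (η : Fin n × ℝ → ℤ) : Fin n × ℝ → ℤ :=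
  fun p =>
    η (p.1, p.2 + 1 / 2) + η (p.1, p.2 - 1 / 2)
      - ∑ i : Fin n, (if i < p.1 then b i p.1 * η (i, p.2 + 1 / 2) else 0)
      - ∑ j : Fin n, (if p.1 < j then b p.1 j * η (j, p.2 - 1 / 2) else 0)

/-- The pairing `η¹ · η² = Σ_{(i,a)} η¹ᵢ(a) η²ᵢ(a)`. -/
noncomputable def dotP {n : ℕ} (η₁ η₂ : Fin n × ℝ → ℤ) : ℤ := ∑ᶠ p, η₁ p * η₂ p

/-- The indicator function `e_{k,a}` of `(k,a)`. -/
noncomputable def eind {n : ℕ} (k : Fin n) (a : ℝ) : Fin n × ℝ → ℤ := fun p => if p = (k, a) then 1 else 0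

/-- Support contained in `I × ℤ`. -/
def SuppInt {n : ℕ} (η : Fin n × ℝ → ℤ) : Prop := ∀ p, η p ≠ 0 → ∃ m : ℤ, p.2 = (m : ℝ)

/-- Support contained in `I × (ℤ + 1/2)`. -/
def SuppHalfInt {n : ℕ} (η : Fin n × ℝ → ℤ) : Prop :=
  ∀ p, η p ≠ 0 → ∃ m : ℤ, p.2 = (m : ℝ) + 1 / 2

/-- The set `E`: functions supported on integer arguments, vanishing for all
sufficiently small arguments. -/
def memE {n : ℕ} (η : Fin n × ℝ → ℤ) : Prop :=
  SuppInt η ∧ ∃ N : ℤ, ∀ (k : Fin n) (a : ℝ), a < (N : ℝ) → η (k, a) = 0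

/-- The set `E[d] = {η[d] : η ∈ E}`. -/
def memEshift {n : ℕ} (d : ℝ) (η : Fin n × ℝ → ℤ) : Prop :=
  ∃ θ, memE θ ∧ η = shift θ d

/-- Functions on `I × (ℤ + 1/2)` vanishing for all sufficiently small arguments;
this is the set `E[1/2] = E[-1/2]`. -/
def memEhalf {n : ℕ} (η : Fin n × ℝ → ℤ) : Prop :=
  SuppHalfInt η ∧ ∃ N : ℤ, ∀ (k : Fin n) (a : ℝ), a < (N : ℝ) → η (k, a) = 0

/-- The strictly upper triangular part `b^>`. -/
def bUpper {n : ℕ} (b : Matrix (Fin n) (Fin n) ℤ) : Matrix (Fin n) (Fin n) ℤ :=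
  Matrix.of fun i j => if i < j then b i j else 0

/-- `E_Q = 1 - b^>`, the matrix of the Euler form. -/
def EQmat {n : ℕ} (b : Matrix (Fin n) (Fin n) ℤ) : Matrix (Fin n) (Fin n) ℤ := 1 - bUpper b

/-- The Euler form `⟨x, y⟩ = xᵀ E_Q y`. -/
def euler {n : ℕ} (b : Matrix (Fin n) (Fin n) ℤ) (x y : Fin n → ℤ) : ℤ :=
  x ⬝ᵥ (EQmat b *ᵥ y)

/-- The class `[Ī_i] = E_Q⁻¹ e_i` of the indecomposable injective with socle `S_i`. -/
noncomputable def Iinj {n : ℕ} (b : Matrix (Fin n) (Fin n) ℤ) (i : Fin n) : Fin n → ℤ :=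
  (EQmat b)⁻¹ *ᵥ Pi.single i 1

/-- The class `[P̄_i] = E_Q⁻ᵀ e_i` of the indecomposable projective with top `S_i`. -/
noncomputable def Pproj {n : ℕ} (b : Matrix (Fin n) (Fin n) ℤ) (i : Fin n) : Fin n → ℤ :=
  ((EQmat b)ᵀ)⁻¹ *ᵥ Pi.single i 1

/-- The Coxeter matrix `Φ = -E_Q⁻¹ E_Qᵀ`. -/
noncomputable def Cox {n : ℕ} (b : Matrix (Fin n) (Fin n) ℤ) : Matrix (Fin n) (Fin n) ℤ :=
  -((EQmat b)⁻¹ * (EQmat b)ᵀ)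

/-- The map `β`, defined `ℤ`-linearly by `β(e_{i,a}) = -Φ^a [Ī_i]` for `a ∈ ℤ`. -/
noncomputable def betaMap {n : ℕ} (b : Matrix (Fin n) (Fin n) ℤ) (η : Fin n × ℝ → ℤ) :
    Fin n → ℤ :=
  ∑ᶠ p : Fin n × ℤ, η (p.1, (p.2 : ℝ)) • ((-(Cox b ^ p.2)) *ᵥ Iinj b p.1)

/-- `𝒩(w¹,w²) = w¹[1/2]·C_q⁻¹w² − w¹[−1/2]·C_q⁻¹w² − w²[1/2]·C_q⁻¹w¹ + w²[−1/2]·C_q⁻¹w¹`,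
where `u₁ = C_q⁻¹ w¹`, `u₂ = C_q⁻¹ w²` are given as arguments. -/
noncomputable def Ncal {n : ℕ} (w₁ w₂ u₁ u₂ : Fin n × ℝ → ℤ) : ℤ :=
  dotP (shift w₁ (1 / 2)) u₂ - dotP (shift w₁ (-(1 / 2))) u₂
    - dotP (shift w₂ (1 / 2)) u₁ + dotP (shift w₂ (-(1 / 2))) u₁

/-- `ℰ'(w¹,w²) = −w¹[1/2]·C_q⁻¹w² + w²[1/2]·C_q⁻¹w¹`, where `u₁ = C_q⁻¹ w¹`,
`u₂ = C_q⁻¹ w²` are given as arguments. -/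
noncomputable def Ecal {n : ℕ} (w₁ w₂ u₁ u₂ : Fin n × ℝ → ℤ) : ℤ :=
  -dotP (shift w₁ (1 / 2)) u₂ + dotP (shift w₂ (1 / 2)) u₁

/-- The B-matrix of the level-1 ice quiver with z-pattern attached to `Q`. -/
def Btilde {n : ℕ} (b : Matrix (Fin n) (Fin n) ℤ) : Matrix (Fin n ⊕ Fin n) (Fin n) ℤ :=
  Matrix.of (Sum.elim (fun i k => b i k)
    (fun j k => -(if j = k then 1 else 0) + (if k < j then b k j else 0)))

/-- The index map: the `ℤ`-linear map on functions supported on `I × {-1, 0}`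
with `ind(e_{k,0}) = e_k` and `ind(e_{k,-1}) = e_{n+k} - e_k`. -/
noncomputable def indMap {n : ℕ} (w : Fin n × ℝ → ℤ) : Fin n ⊕ Fin n → ℤ :=
  Sum.elim (fun k => w (k, 0) - w (k, -1)) (fun k => w (k, -1))

end GQV


open Matrix GQV

/-- The slice of `η` at `m + 1/2`. -/
noncomputable def slice {n : ℕ} (η : Fin n × ℝ → ℤ) (m : ℤ) : Fin n → ℤ :=
  fun k => η (k, (m : ℝ) + 1 / 2)

theorem EQ_det {n : ℕ} (b : Matrix (Fin n) (Fin n) ℤ) : (EQmat b).det = 1 := by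
  rw [Matrix.det_of_isUpperTriangular]
  · simp [EQmat, bUpper]
  · intro i j hij
    have h : j < i := hij
    simp [EQmat, bUpper, Matrix.one_apply, h.ne', not_lt.mpr h.le]

theorem Cq_slice {n : ℕ} (b : Matrix (Fin n) (Fin n) ℤ) (η : Fin n × ℝ → ℤ) (m : ℤ) :
    (EQmat b)ᵀ *ᵥ slice η m + EQmat b *ᵥ slice η (m - 1) = fun k => Cq b η (k, (m : ℝ)) := by
  funext k
  have e : ((m - 1 : ℤ) : ℝ) + 1 / 2 = (m : ℝ) - 1 / 2 := by push_cast; ring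
  have e1 : ((bUpper b)ᵀ *ᵥ slice η m) k
      = ∑ i : Fin n, (if i < k then b i k * η (i, (m : ℝ) + 1 / 2) else 0) := by
    simp only [Matrix.mulVec, dotProduct, bUpper, slice, Matrix.transpose_apply, Matrix.of_apply,
      ite_mul, zero_mul]
  have e2 : ((bUpper b) *ᵥ slice η (m - 1)) k
      = ∑ j : Fin n, (if k < j then b k j * η (j, (m : ℝ) - 1 / 2) else 0) := by
    simp only [Matrix.mulVec, dotProduct, bUpper, slice, Matrix.of_apply,
      ite_mul, zero_mul, e]
  simp only [EQmat, Matrix.transpose_sub, Matrix.transpose_one, Matrix.sub_mulVec,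
    Matrix.one_mulVec, Pi.add_apply, Pi.sub_apply, e1, e2, Cq]
  simp only [slice, e]
  ring

theorem slice_rec {n : ℕ} (b : Matrix (Fin n) (Fin n) ℤ) (η : Fin n × ℝ → ℤ) (m : ℤ)
    (j : Fin n) (d : ℤ) (h : Cq b η = eind j (d : ℝ)) :
    slice η m = ((EQmat b)⁻¹)ᵀ *ᵥ (if m = d then Pi.single j 1 else 0)
      + (-(((EQmat b)⁻¹)ᵀ * EQmat b)) *ᵥ slice η (m - 1) := by
  have h1 := Cq_slice b η m
  have h2 : (fun k => Cq b η (k, (m : ℝ))) = if m = d then Pi.single j 1 else 0 := by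
    funext k
    rw [h]
    by_cases hm : m = d
    · simp [eind, hm, Pi.single_apply]
    · simp [eind, hm]
  have hu : IsUnit (EQmat b).det := by rw [EQ_det]; exact isUnit_one
  have hA : ((EQmat b)⁻¹)ᵀ * (EQmat b)ᵀ = 1 := by
    rw [← Matrix.transpose_mul, Matrix.mul_nonsing_inv _ hu, Matrix.transpose_one]
  rw [← h2, ← h1, Matrix.mulVec_add, Matrix.mulVec_mulVec, Matrix.mulVec_mulVec, hA,
    Matrix.neg_mulVec, Matrix.one_mulVec]
  simp

theorem slice_zero {n : ℕ} (b : Matrix (Fin n) (Fin n) ℤ) (η : Fin n × ℝ → ℤ)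
    (j : Fin n) (d : ℤ) (h : Cq b η = eind j (d : ℝ)) (hη : memEhalf η) (m : ℤ) (hm : m < d) :
    slice η m = 0 := by
  obtain ⟨-, N, hN⟩ := hη
  have base : ∀ m : ℤ, m < N → slice η m = 0 := by
    intro m hm
    funext k
    apply hN
    have : (m : ℝ) + 1 ≤ N := by exact_mod_cast hm
    linarith
  have key : ∀ t : ℕ, ∀ m : ℤ, m < N + t → m < d → slice η m = 0 := by
    intro t
    induction t with
    | zero => intro m hm _; exact base m (by simpa using hm)
    | succ t ih =>
      intro m hm hmd
      rw [slice_rec b η m j d h, ih (m - 1) (by push_cast at hm; omega) (by omega)]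
      simp [hmd.ne]
  exact key (m - N + 1).toNat m (by omega) hm

theorem slice_formula {n : ℕ} (b : Matrix (Fin n) (Fin n) ℤ) (η : Fin n × ℝ → ℤ)
    (i : Fin n) (h : Cq b η = eind i (0 : ℝ)) (hη : memEhalf η) (m : ℕ) :
    slice η (m : ℤ) = ((-(((EQmat b)⁻¹)ᵀ * EQmat b)) ^ m * ((EQmat b)⁻¹)ᵀ) *ᵥ Pi.single i 1 := by
  have h' : Cq b η = eind i ((0 : ℤ) : ℝ) := by simpa using h
  induction m with
  | zero =>
    rw [slice_rec b η _ i 0 h', slice_zero b η i 0 h' hη _ (by simp)]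
    simp
  | succ m ih =>
    rw [slice_rec b η _ i 0 h']
    have e : ((m + 1 : ℕ) : ℤ) - 1 = m := by push_cast; ring
    have e' : ((m + 1 : ℕ) : ℤ) ≠ 0 := by push_cast; omega
    rw [e, ih, if_neg e', Matrix.mulVec_zero, zero_add, Matrix.mulVec_mulVec, ← mul_assoc,
      ← pow_succ']

theorem dot_shift {n : ℕ} (k : Fin n) (a s : ℝ) (u : Fin n × ℝ → ℤ) :
    dotP (shift (eind k a) s) u = u (k, a - s) := by
  unfold dotP
  rw [finsum_eq_single _ (k, a - s)]
  · simp [shift, eind]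
  · rintro ⟨k', x⟩ hx
    have : ¬ (k' = k ∧ x + s = a) := by
      rintro ⟨rfl, rfl⟩
      exact hx (by simp)
    simp [shift, eind, this]

theorem beta_eind {n : ℕ} (b : Matrix (Fin n) (Fin n) ℤ) (k : Fin n) (m : ℤ) :
    betaMap b (eind k (m : ℝ)) = (-(Cox b ^ m)) *ᵥ Iinj b k := by
  unfold betaMap
  rw [finsum_eq_single _ (k, m)]
  · simp [eind]
  · rintro ⟨k', x⟩ hx
    have : ¬ (k' = k ∧ x = m) := by
      rintro ⟨rfl, rfl⟩
      exact hx rfl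
    simp [eind, this]

theorem dot_symm_form {n : ℕ} (M : Matrix (Fin n) (Fin n) ℤ) (x y : Fin n → ℤ) :
    x ⬝ᵥ (M *ᵥ y) = y ⬝ᵥ (Mᵀ *ᵥ x) := by
  rw [Matrix.dotProduct_mulVec, dotProduct_comm, Matrix.mulVec_transpose]

theorem dot_cols {n : ℕ} (X Y : Matrix (Fin n) (Fin n) ℤ) (i j : Fin n) :
    (X *ᵥ Pi.single j 1) ⬝ᵥ (Y *ᵥ Pi.single i 1) = ((Xᵀ * Y) *ᵥ Pi.single i 1) j := by
  simp [Matrix.mul_apply, dotProduct]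

/-- for `d ≥ 1`, `𝒩(e_i(0), e_j(d)) = (β(e_i(0)), β(e_j(d)))`, the
symmetrized Euler form. Here `u₁ = C_q⁻¹ e_i(0)` and `u₂ = C_q⁻¹ e_j(d)`. -/
theorem Ncal_eq_symmetrized_euler (n : ℕ) (hn : 0 < n) (b : Matrix (Fin n) (Fin n) ℤ)
    (hskew : bᵀ = -b) (hsign : ∀ i j : Fin n, i < j → 0 ≤ b i j)
    (i j : Fin n) (d : ℤ) (hd : 1 ≤ d) (u₁ u₂ : Fin n × ℝ → ℤ)
    (hu₁ : GQV.memEhalf u₁) (hu₂ : GQV.memEhalf u₂)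
    (hu₁Cq : GQV.Cq b u₁ = GQV.eind i (0 : ℝ))
    (hu₂Cq : GQV.Cq b u₂ = GQV.eind j (d : ℝ)) :
    GQV.Ncal (GQV.eind i (0 : ℝ)) (GQV.eind j (d : ℝ)) u₁ u₂
      = GQV.euler b (GQV.betaMap b (GQV.eind i (0 : ℝ))) (GQV.betaMap b (GQV.eind j (d : ℝ)))
        + GQV.euler b (GQV.betaMap b (GQV.eind j (d : ℝ))) (GQV.betaMap b (GQV.eind i (0 : ℝ))) := by
  have hu : IsUnit (EQmat b).det := by rw [EQ_det]; exact isUnit_one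
  obtain ⟨D, rfl⟩ : ∃ D : ℕ, d = ((D + 1 : ℕ) : ℤ) := ⟨(d - 1).toNat, by omega⟩
  have f1 := congrFun (slice_formula b u₁ i hu₁Cq hu₁ (D + 1)) j
  have f0 := congrFun (slice_formula b u₁ i hu₁Cq hu₁ D) j
  have z0 := congrFun (slice_zero b u₂ j _ hu₂Cq hu₂ 0 (by omega)) i
  have z1 := congrFun (slice_zero b u₂ j _ hu₂Cq hu₂ (-1) (by omega)) i
  have b0 : betaMap b (eind i (0 : ℝ)) = (-(1 : Matrix (Fin n) (Fin n) ℤ)) *ᵥ Iinj b i := by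
    have := beta_eind b i 0
    simpa using this
  rw [b0, beta_eind, zpow_natCast]
  unfold Ncal
  rw [dot_shift, dot_shift, dot_shift, dot_shift]
  have r1 : (0 : ℝ) - 1 / 2 = ((-1 : ℤ) : ℝ) + 1 / 2 := by norm_num
  have r2 : (0 : ℝ) - -(1 / 2) = ((0 : ℤ) : ℝ) + 1 / 2 := by norm_num
  have r3 : (((D + 1 : ℕ) : ℤ) : ℝ) - 1 / 2 = ((D : ℤ) : ℝ) + 1 / 2 := by push_cast; ring
  have r4 : (((D + 1 : ℕ) : ℤ) : ℝ) - -(1 / 2) = (((D + 1 : ℕ) : ℤ) : ℝ) + 1 / 2 := by ring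
  rw [r1, r2, r3, r4]
  simp only [slice] at f1 f0 z0 z1
  rw [f1, f0, z0, z1]
  set E := EQmat b with hE
  set A := E⁻¹ with hA
  set P : Matrix (Fin n) (Fin n) ℤ := -(Aᵀ * E) with hP
  have hEA : E * A = 1 := Matrix.mul_nonsing_inv _ hu
  have hAE : A * E = 1 := Matrix.nonsing_inv_mul _ hu
  have hAEt : Aᵀ * Eᵀ = 1 := by rw [← Matrix.transpose_mul, hEA, Matrix.transpose_one]
  have hC : Cox b = -(A * Eᵀ) := rfl
  have hCt : ∀ m : ℕ, Aᵀ * (Cox b ^ m)ᵀ = P ^ m * Aᵀ := by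
    intro m
    induction m with
    | zero => simp
    | succ m ih =>
      have c1 : Aᵀ * (Cox b)ᵀ = P * Aᵀ := by
        rw [hC, hP]; simp [Matrix.transpose_mul, mul_assoc]
      rw [pow_succ', Matrix.transpose_mul, ← mul_assoc, ih, mul_assoc, pow_succ, mul_assoc,
        ← c1]
  have hi : Iinj b i = A *ᵥ Pi.single i 1 := rfl
  have hj : Iinj b j = A *ᵥ Pi.single j 1 := rfl
  have g1 : euler b (-(Cox b ^ (D + 1)) *ᵥ Iinj b j) (-1 *ᵥ Iinj b i)
      = ((P ^ (D + 1) * Aᵀ) *ᵥ Pi.single i 1) j := by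
    unfold euler
    rw [hi, hj, ← hE, Matrix.mulVec_mulVec, Matrix.mulVec_mulVec, Matrix.mulVec_mulVec, dot_cols,
      ← hCt]
    have : (-(Cox b ^ (D + 1)) * A)ᵀ * (E * (-1 * A)) = Aᵀ * (Cox b ^ (D + 1))ᵀ := by
      rw [neg_one_mul, mul_neg, hEA, neg_mul, Matrix.transpose_neg, neg_mul_neg, mul_one,
        Matrix.transpose_mul]
    rw [mul_assoc E, this]
  have g2 : euler b (-1 *ᵥ Iinj b i) (-(Cox b ^ (D + 1)) *ᵥ Iinj b j)
      = - ((P ^ D * Aᵀ) *ᵥ Pi.single i 1) j := by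
    unfold euler
    rw [hi, hj, ← hE, dotProduct_comm, Matrix.mulVec_mulVec, Matrix.mulVec_mulVec,
      Matrix.mulVec_mulVec, dot_cols]
    have : (E * (-(Cox b ^ (D + 1)) * A))ᵀ * (-1 * A) = -(P ^ D * Aᵀ) := by
      rw [neg_one_mul, neg_mul, mul_neg E, Matrix.transpose_neg, neg_mul_neg,
        Matrix.transpose_mul, Matrix.transpose_mul, hCt, mul_assoc, mul_assoc, ← mul_assoc Aᵀ,
        hAEt, one_mul, pow_succ, mul_assoc, hP, neg_mul, mul_assoc, hEA, mul_one, mul_neg]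
    rw [mul_assoc E, this, Matrix.neg_mulVec, Pi.neg_apply]
  rw [g1, g2]
  simp only [Pi.zero_apply]
  ring
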